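/- Let R be a commutative ring and S a finitely presented R-algebra. For every prime ideal 𝔭 of S with contraction 𝔭' to R, the following are equivalent: (i) there exists g ∈ S \ 𝔭 such that the principal localization S_g is formally smooth over R; (ii) there exists g ∈ S \ 𝔭 such that S_g is a standard smooth R-algebra; (iii) the induced map R_{𝔭'} → S_𝔭 is formally smooth; (iv) S_𝔭 is isomorphic as an R_{𝔭'}-algebra to a localization of a standard smooth R_{𝔭'}-algebra. -/

import Mathlib

/-- An `R`-algebra `S` is *standard smooth* if `S ≅ R[x_1,…,x_n]/(f_1,…,f_c)` with
`c ≤ n` such that the `c × c` matrix with `(i,j)`-entry the image of `∂f_i/∂x_j`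
(`1 ≤ i, j ≤ c`) has determinant invertible in `S` (equivalently, in the quotient). -/
def StandardSmoothAlgebra (R S : Type) [CommRing R] [CommRing S] [Algebra R S] : Prop :=
  ∃ (n c : ℕ) (hcn : c ≤ n) (f : Fin c → MvPolynomial (Fin n) R)
    (_ : (MvPolynomial (Fin n) R ⧸ Ideal.span (Set.range f)) ≃ₐ[R] S),
    IsUnit (Matrix.det (Matrix.of fun i j : Fin c =>
      Ideal.Quotient.mk (Ideal.span (Set.range f))
        (MvPolynomial.pderiv (Fin.castLE hcn j) (f i))))

/-- `A` is (isomorphic as an `R`-algebra to) a localization of a standard smooth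
`R`-algebra. -/
def IsLocalizationOfStandardSmooth (R A : Type) [CommRing R] [CommRing A]
    [Algebra R A] : Prop :=
  ∃ (T : Type) (i1 : CommRing T),
    letI := i1
    ∃ (i2 : Algebra R T),
      letI := i2
      StandardSmoothAlgebra R T ∧
        ∃ M : Submonoid T, Nonempty (A ≃ₐ[R] Localization M)

open Algebra TensorProduct

theorem StandardSmoothAlgebra.isStandardSmooth {R S : Type} [CommRing R] [CommRing S]
    [Algebra R S] (h : StandardSmoothAlgebra R S) : IsStandardSmooth R S := by
  obtain ⟨n, c, hcn, f, e, hf⟩ := h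
  let P : PreSubmersivePresentation R (MvPolynomial (Fin n) R ⧸ Ideal.span (Set.range f))
      (Fin n) (Fin c) :=
    { Presentation.naive with
      map := Fin.castLE hcn
      map_inj := Fin.castLE_injective hcn }
  have hP : IsUnit P.jacobian := by
    rw [P.jacobian_eq_jacobiMatrix_det, RingHom.map_det, ← Matrix.det_transpose]
    convert! hf using 2
    ext i j
    rw [Matrix.transpose_apply, RingHom.mapMatrix_apply, Matrix.map_apply, P.jacobiMatrix_apply]
    rfl
  let Q : SubmersivePresentation R (MvPolynomial (Fin n) R ⧸ Ideal.span (Set.range f))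
      (Fin n) (Fin c) := { P with jacobian_isUnit := hP }
  exact (Q.ofAlgEquiv e).isStandardSmooth

/-- The variables can be ordered so that the Jacobian involves the first ones. -/
theorem Algebra.IsStandardSmooth.standardSmoothAlgebra {R S : Type} [CommRing R] [CommRing S]
    [Algebra R S] (h : IsStandardSmooth R S) : StandardSmoothAlgebra R S := by
  obtain ⟨ι, σ, _, _, ⟨P₀⟩⟩ := h.out
  let P₁ := P₀.reindex (Finite.equivFin ι).symm (Finite.equivFin σ).symm
  have hcn : Nat.card σ ≤ Nat.card ι := P₀.card_relations_le_card_vars_of_isFinite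
  obtain ⟨π, hπ⟩ := Equiv.Perm.exists_extending_pair (Fin.castLE hcn) P₁.map
    (Fin.castLE_injective hcn) P₁.map_inj
  let P := P₁.reindex π (Equiv.refl _)
  have hmap (j) : P.map j = Fin.castLE hcn j := by
    change π.symm (P₁.map j) = _
    rw [← hπ, π.symm_apply_apply]
  let e : (MvPolynomial (Fin (Nat.card ι)) R ⧸ Ideal.span (Set.range P.relation)) ≃ₐ[R] S :=
    (Ideal.quotientEquivAlgOfEq R P.span_range_relation_eq_ker).trans
      (P.quotientEquiv.restrictScalars R)
  refine ⟨_, _, hcn, P.relation, e, ?_⟩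
  rw [← MulEquiv.isUnit_map e, ← AlgEquiv.coe_ringEquiv, ← RingEquiv.coe_toRingHom,
    RingHom.map_det, ← Matrix.det_transpose]
  convert! P.jacobian_isUnit
  rw [P.jacobian_eq_jacobiMatrix_det, RingHom.map_det]
  congr 1
  ext i j
  simp only [Matrix.transpose_apply, RingHom.mapMatrix_apply, Matrix.map_apply,
    P.jacobiMatrix_apply, Matrix.of_apply, hmap]
  rfl

theorem standardSmoothAlgebra_iff_isStandardSmooth {R S : Type} [CommRing R] [CommRing S]
    [Algebra R S] : StandardSmoothAlgebra R S ↔ IsStandardSmooth R S :=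
  ⟨fun h ↦ h.isStandardSmooth, fun h ↦ h.standardSmoothAlgebra⟩

theorem IsLocalizationOfStandardSmooth.formallySmooth {R A : Type} [CommRing R] [CommRing A]
    [Algebra R A] (h : IsLocalizationOfStandardSmooth R A) : FormallySmooth R A := by
  obtain ⟨T, _, _, hT, M, ⟨e⟩⟩ := h
  have := hT.isStandardSmooth
  have : FormallySmooth R T := inferInstance
  exact .of_equiv e.symm

/-- If `A` is standard smooth over `R`, and `B` is a localization of `A` in which a submonoid `M`
of `R` becomes invertible, then `B` is a localization of a standard smooth algebra over `M⁻¹R`. -/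
theorem isLocalizationOfStandardSmooth_of_isLocalization {R R' A B : Type} [CommRing R]
    [CommRing R'] [CommRing A] [CommRing B] [Algebra R R'] [Algebra R A] [Algebra R B]
    [Algebra A B] [Algebra R' B] [IsScalarTower R A B] [IsScalarTower R R' B]
    [IsStandardSmooth R A] (M : Submonoid R) [IsLocalization M R'] (N : Submonoid A)
    [IsLocalization N B] (hMN : algebraMapSubmonoid A M ≤ N) :
    IsLocalizationOfStandardSmooth R' B := by
  let φ : R' ⊗[R] A →ₐ[R'] B :=
    Algebra.TensorProduct.lift (ofId R' B) (IsScalarTower.toAlgHom R A B) fun _ _ ↦ .all _ _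
  let : Algebra A (R' ⊗[R] A) := Algebra.TensorProduct.rightAlgebra
  let : Algebra (R' ⊗[R] A) B := φ.toRingHom.toAlgebra
  have : IsScalarTower R' (R' ⊗[R] A) B := .of_algebraMap_eq' φ.comp_algebraMap.symm
  have : IsScalarTower A (R' ⊗[R] A) B := .of_algebraMap_eq fun a ↦ by
    change algebraMap A B a = φ (1 ⊗ₜ a)
    simp [φ]
  have : IsLocalization (algebraMapSubmonoid A M) (R' ⊗[R] A) := inferInstance
  have := IsLocalization.isLocalization_of_submonoid_le (R' ⊗[R] A) B _ N hMN
  exact ⟨R' ⊗[R] A, inferInstance, inferInstance,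
    standardSmoothAlgebra_iff_isStandardSmooth.mpr inferInstance,
    N.map (algebraMap A (R' ⊗[R] A)),
    ⟨(IsLocalization.algEquiv (N.map (algebraMap A (R' ⊗[R] A))) B
      (Localization (N.map (algebraMap A (R' ⊗[R] A))))).restrictScalars R'⟩⟩

/-- For a finitely presented `R`-algebra `S` and a prime `𝔭` of `S`
with contraction `𝔭'` to `R`, the following are equivalent:
(i) some `S_g` (`g ∉ 𝔭`) is formally smooth over `R`;
(ii) some `S_g` (`g ∉ 𝔭`) is a standard smooth `R`-algebra;
(iii) the induced map `R_{𝔭'} → S_𝔭` is formally smooth;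
(iv) `S_𝔭` is isomorphic as an `R_{𝔭'}`-algebra to a localization of a standard smooth
`R_{𝔭'}`-algebra. -/
theorem smoothness_tfae_atPrime
    {R S : Type} [CommRing R] [CommRing S] [Algebra R S]
    (hfp : Algebra.FinitePresentation R S) (𝔭 : Ideal S) [𝔭.IsPrime] :
    letI : Algebra (Localization.AtPrime (𝔭.comap (algebraMap R S)))
        (Localization.AtPrime 𝔭) :=
      (Localization.localRingHom (𝔭.comap (algebraMap R S)) 𝔭 (algebraMap R S)
        rfl).toAlgebra
    List.TFAE
      [ ∃ g ∉ 𝔭, Algebra.FormallySmooth R (Localization.Away g),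
        ∃ g ∉ 𝔭, StandardSmoothAlgebra R (Localization.Away g),
        Algebra.FormallySmooth (Localization.AtPrime (𝔭.comap (algebraMap R S)))
          (Localization.AtPrime 𝔭),
        IsLocalizationOfStandardSmooth (Localization.AtPrime (𝔭.comap (algebraMap R S)))
          (Localization.AtPrime 𝔭) ] := by
  let : Algebra (Localization.AtPrime (𝔭.comap (algebraMap R S))) (Localization.AtPrime 𝔭) :=
    (Localization.localRingHom (𝔭.comap (algebraMap R S)) 𝔭 (algebraMap R S) rfl).toAlgebra
  have : IsScalarTower R (Localization.AtPrime (𝔭.comap (algebraMap R S)))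
      (Localization.AtPrime 𝔭) := .of_algebraMap_eq fun x ↦ by
    rw [RingHom.algebraMap_toAlgebra, Localization.localRingHom_to_map,
      IsScalarTower.algebraMap_apply R S]
  simp only [standardSmoothAlgebra_iff_isStandardSmooth]
  tfae_have 2 → 1 := fun ⟨g, hg, _⟩ ↦ ⟨g, hg, inferInstance⟩
  tfae_have 1 → 3 := fun ⟨g, hg, h⟩ ↦ by
    have : IsSmoothAt R 𝔭 :=
      basicOpen_subset_smoothLocus_iff.mpr h (show ⟨𝔭, ‹_›⟩ ∈ PrimeSpectrum.basicOpen g from hg)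
    exact .localization_base (𝔭.comap (algebraMap R S)).primeCompl
  tfae_have 3 → 2 := fun h ↦ by
    have : FormallySmooth R (Localization.AtPrime (𝔭.comap (algebraMap R S))) :=
      .of_isLocalization (𝔭.comap (algebraMap R S)).primeCompl
    have : IsSmoothAt R 𝔭 :=
      .comp R (Localization.AtPrime (𝔭.comap (algebraMap R S))) (Localization.AtPrime 𝔭)
    exact IsSmoothAt.exists_notMem_isStandardSmooth R 𝔭
  tfae_have 4 → 3 := fun h ↦ h.formallySmooth
  tfae_have 2 → 4 := fun ⟨g, hg, _⟩ ↦ by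
    have hle : Submonoid.powers g ≤ 𝔭.primeCompl := Submonoid.powers_le.mpr hg
    let : Algebra (Localization.Away g) (Localization.AtPrime 𝔭) :=
      IsLocalization.localizationAlgebraOfSubmonoidLe _ _ (.powers g) 𝔭.primeCompl hle
    have : IsScalarTower S (Localization.Away g) (Localization.AtPrime 𝔭) :=
      IsLocalization.localization_isScalarTower_of_submonoid_le _ _ (.powers g) 𝔭.primeCompl hle
    have : IsScalarTower R (Localization.Away g) (Localization.AtPrime 𝔭) :=
      .to₁₃₄ R S _ _
    have := IsLocalization.isLocalization_of_submonoid_le (Localization.Away g)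
      (Localization.AtPrime 𝔭) (.powers g) 𝔭.primeCompl hle
    refine isLocalizationOfStandardSmooth_of_isLocalization (A := Localization.Away g)
      (𝔭.comap (algebraMap R S)).primeCompl
      (𝔭.primeCompl.map (algebraMap S (Localization.Away g))) ?_
    rintro _ ⟨x, hx, rfl⟩
    exact ⟨algebraMap R S x, hx, (IsScalarTower.algebraMap_apply R S _ x).symm⟩
  tfae_finish
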